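/- arXiv:1410.6111 — 2 statements merged into one kernel-verified Lean document; each statement's English description precedes it below -/
import Mathlib

section
/- (Björner–Walker) Let P be a finite poset and let C be a convex subset of P (i.e., if x < y < z with x, z ∈ C then y ∈ C). Then μ(P) = μ(P∖C) + Σ_{x,y ∈ C, x ≤ y} μ(Û_x)·μ(F̂_y), where Û_x and F̂_y are taken in P and P∖C carries the induced order. -/
open scoped Classical

/-- The Möbius function of the subposet `X` of the finite poset `α`: the number of chains of
`X` of odd cardinality minus the number of chains of `X` of even cardinality (the empty chain
counting as a chain of even cardinality, so `mu α ∅ = -1`). -/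
noncomputable def mu (α : Type*) [PartialOrder α] [Fintype α] (X : Set α) : ℤ :=
  ∑ s ∈ Finset.univ.filter
      (fun s : Finset α => (↑s : Set α) ⊆ X ∧ IsChain (· ≤ ·) (↑s : Set α)),
    (-1 : ℤ) ^ (s.card + 1)

theorem mu_point {α : Type*} [PartialOrder α] [Fintype α] (X : Set α) (m : α) (hm : m ∈ X) :
    mu α X = mu α (X \ {m}) + mu α {a | a ∈ X ∧ a < m} * mu α {a | a ∈ X ∧ m < a} := by
  unfold mu
  rw [← Finset.sum_filter_not_add_sum_filter _ (fun s : Finset α => m ∈ s)]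
  congr 1
  · apply Finset.sum_congr _ (fun _ _ => rfl)
    ext s
    simp only [Finset.mem_filter, Finset.mem_univ, true_and]
    constructor
    · rintro ⟨⟨h1, h2⟩, h3⟩
      exact ⟨fun a ha => ⟨h1 ha, fun h => h3 (h ▸ ha)⟩, h2⟩
    · rintro ⟨h1, h2⟩
      exact ⟨⟨fun a ha => (h1 ha).1, h2⟩, fun h => (h1 h).2 rfl⟩
  · rw [Finset.sum_mul_sum, ← Finset.sum_product']
    refine Finset.sum_bij'
      (fun s _ => (s.filter (· < m), s.filter (m < ·)))
      (fun p _ => insert m (p.1 ∪ p.2)) ?_ ?_ ?_ ?_ ?_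
    · intro s hs
      simp only [Finset.mem_filter, Finset.mem_univ, true_and, Finset.mem_product] at hs ⊢
      obtain ⟨⟨h1, h2⟩, h3⟩ := hs
      refine ⟨⟨?_, ?_⟩, ?_, ?_⟩
      · intro a ha
        simp at ha
        exact ⟨h1 ha.1, ha.2⟩
      · exact h2.mono (by intro a ha; simp at ha; exact ha.1)
      · intro a ha
        simp at ha
        exact ⟨h1 ha.1, ha.2⟩
      · exact h2.mono (by intro a ha; simp at ha; exact ha.1)
    · rintro ⟨A, B⟩ hp
      simp only [Finset.mem_filter, Finset.mem_univ, true_and, Finset.mem_product] at hp ⊢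
      obtain ⟨⟨hA, hA'⟩, hB, hB'⟩ := hp
      refine ⟨⟨?_, ?_⟩, by simp⟩
      · intro a ha
        simp at ha
        rcases ha with rfl | ha | ha
        · exact hm
        · exact (hA ha).1
        · exact (hB ha).1
      · intro a ha b hb hab
        simp at ha hb
        rcases ha with rfl | ha | ha <;> rcases hb with rfl | hb | hb
        · exact (hab rfl).elim
        · exact Or.inr (hA hb).2.le
        · exact Or.inl (hB hb).2.le
        · exact Or.inl (hA ha).2.le
        · exact hA' ha hb hab
        · exact Or.inl ((hA ha).2.trans (hB hb).2).le
        · exact Or.inr (hB ha).2.le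
        · exact Or.inr ((hA hb).2.trans (hB ha).2).le
        · exact hB' ha hb hab
    · intro s hs
      simp only [Finset.mem_filter, Finset.mem_univ, true_and] at hs
      obtain ⟨⟨h1, h2⟩, h3⟩ := hs
      ext a
      simp only [Finset.mem_insert, Finset.mem_union, Finset.mem_filter]
      constructor
      · rintro (rfl | h | h)
        · exact h3
        · exact h.1
        · exact h.1
      · intro ha
        by_cases ham : a = m
        · exact Or.inl ham
        · rcases h2 ha h3 ham with h | h
          · exact Or.inr (Or.inl ⟨ha, lt_of_le_of_ne h ham⟩)
          · exact Or.inr (Or.inr ⟨ha, lt_of_le_of_ne h (Ne.symm ham)⟩)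
    · rintro ⟨A, B⟩ hp
      simp only [Finset.mem_filter, Finset.mem_univ, true_and, Finset.mem_product] at hp
      obtain ⟨⟨hA, hA'⟩, hB, hB'⟩ := hp
      have hA2 : ∀ a ∈ A, a < m := fun a ha => (hA ha).2
      have hB2 : ∀ a ∈ B, m < a := fun a ha => (hB ha).2
      ext a
      · simp only [Finset.mem_insert, Finset.mem_union, Finset.mem_filter]
        constructor
        · rintro ⟨rfl | h | h, h'⟩
          · exact (lt_irrefl _ h').elim
          · exact h
          · exact (lt_asymm h' (hB2 a h)).elim
        · exact fun h => ⟨Or.inr (Or.inl h), hA2 a h⟩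
      · simp only [Finset.mem_insert, Finset.mem_union, Finset.mem_filter]
        constructor
        · rintro ⟨rfl | h | h, h'⟩
          · exact (lt_irrefl _ h').elim
          · exact (lt_asymm h' (hA2 a h)).elim
          · exact h
        · exact fun h => ⟨Or.inr (Or.inr h), hB2 a h⟩
    · intro s hs
      simp only [Finset.mem_filter, Finset.mem_univ, true_and] at hs
      obtain ⟨⟨h1, h2⟩, h3⟩ := hs
      have hs : s = insert m (s.filter (· < m) ∪ s.filter (m < ·)) := by
        ext a
        simp only [Finset.mem_insert, Finset.mem_union, Finset.mem_filter]
        constructor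
        · intro ha
          by_cases ham : a = m
          · exact Or.inl ham
          · rcases h2 ha h3 ham with h | h
            · exact Or.inr (Or.inl ⟨ha, lt_of_le_of_ne h ham⟩)
            · exact Or.inr (Or.inr ⟨ha, lt_of_le_of_ne h (Ne.symm ham)⟩)
        · rintro (rfl | h | h)
          · exact h3
          · exact h.1
          · exact h.1
      have hc : s.card = (s.filter (· < m)).card + (s.filter (m < ·)).card + 1 := by
        conv_lhs => rw [hs]
        rw [Finset.card_insert_of_notMem (by simp), Finset.card_union_of_disjoint]
        rw [Finset.disjoint_left]
        intro a ha hb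
        simp only [Finset.mem_filter] at ha hb
        exact lt_asymm ha.2 hb.2
      rw [hc]
      ring

theorem mu_empty' (α : Type*) [PartialOrder α] [Fintype α] : mu α (∅ : Set α) = -1 := by
  unfold mu
  have : (Finset.univ.filter
      (fun s : Finset α => (↑s : Set α) ⊆ (∅ : Set α) ∧ IsChain (· ≤ ·) (↑s : Set α))) = {∅} := by
    ext s
    simp only [Finset.mem_filter, Finset.mem_univ, true_and, Set.subset_empty_iff,
      Finset.coe_eq_empty, Finset.mem_singleton]
    constructor
    · exact fun h => h.1
    · rintro rfl
      exact ⟨rfl, by simp⟩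
  rw [this]
  simp

theorem mu_upper {α : Type*} [PartialOrder α] [Fintype α] (Q : Set α) (n : ℕ) :
    ∀ D : Finset α, D.card = n → (∀ x ∈ D, x ∈ Q) → (∀ x ∈ D, ∀ y ∈ Q, x < y → y ∈ D) →
    mu α Q = mu α (Q \ ↑D) - ∑ x ∈ D, mu α {a | a ∈ Q ∧ a < x} := by
  induction n with
  | zero =>
    intro D hD _ _
    rw [Finset.card_eq_zero] at hD
    subst hD
    simp
  | succ n ih =>
    intro D hD hQ hU
    have hne : D.Nonempty := by rw [← Finset.card_pos]; omega
    obtain ⟨m, hmin⟩ := D.exists_minimal hne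
    have hm : m ∈ D := hmin.1
    have hmin' : ∀ x ∈ D, ¬ x < m := fun x hx h => hmin.not_lt hx h
    rw [ih (D.erase m) (by rw [Finset.card_erase_of_mem hm]; omega)
      (fun x hx => hQ x (Finset.mem_of_mem_erase hx))
      (fun x hx y hy hxy => Finset.mem_erase.2 ⟨by
        rintro rfl
        exact hmin' x (Finset.mem_of_mem_erase hx) hxy,
        hU x (Finset.mem_of_mem_erase hx) y hy hxy⟩)]
    rw [mu_point (Q \ ↑(D.erase m)) m ⟨hQ m hm, by simp⟩]
    have e1 : (Q \ ↑(D.erase m)) \ {m} = Q \ (↑D : Set α) := by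
      ext a
      simp only [Set.mem_sdiff, Finset.mem_coe, Finset.mem_erase, Set.mem_singleton_iff]
      constructor
      · rintro ⟨⟨h1, h2⟩, h3⟩
        exact ⟨h1, fun h => h2 ⟨h3, h⟩⟩
      · rintro ⟨h1, h2⟩
        exact ⟨⟨h1, fun h => h2 h.2⟩, fun h => h2 (h ▸ hm)⟩
    have e2 : {a | a ∈ Q \ (↑(D.erase m) : Set α) ∧ a < m} = {a | a ∈ Q ∧ a < m} := by
      ext a
      simp only [Set.mem_ofPred_eq, Set.mem_sdiff, Finset.mem_coe, Finset.mem_erase]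
      constructor
      · rintro ⟨⟨h1, h2⟩, h3⟩
        exact ⟨h1, h3⟩
      · rintro ⟨h1, h2⟩
        exact ⟨⟨h1, fun h => hmin' a h.2 h2⟩, h2⟩
    have e3 : {a | a ∈ Q \ (↑(D.erase m) : Set α) ∧ m < a} = ∅ := by
      ext a
      simp only [Set.mem_ofPred_eq, Set.mem_sdiff, Finset.mem_coe, Finset.mem_erase,
        Set.mem_empty_iff_false, iff_false]
      rintro ⟨⟨h1, h2⟩, h3⟩
      exact h2 ⟨h3.ne', hU m hm a h1 h3⟩
    rw [e1, e2, e3, mu_empty', ← Finset.add_sum_erase D _ hm]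
    ring

theorem mu_conv {α : Type*} [PartialOrder α] [Fintype α] (n : ℕ) :
    ∀ C : Finset α, C.card = n →
    (∀ x y z : α, x < y → y < z → x ∈ C → z ∈ C → y ∈ C) →
    mu α Set.univ = mu α (↑C : Set α)ᶜ +
      ∑ y ∈ C, (∑ x ∈ C.filter (· ≤ y), mu α {a | a < x}) * mu α {b | y < b} := by
  induction n with
  | zero =>
    intro D hD _
    rw [Finset.card_eq_zero] at hD
    subst hD
    simp
  | succ n ih =>
    intro C hn hC
    have hne : C.Nonempty := by rw [← Finset.card_pos]; omega
    obtain ⟨m, hmax⟩ := C.exists_maximal hne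
    have hm : m ∈ C := hmax.1
    have hmax' : ∀ x ∈ C, ¬ m < x := fun x hx h => hmax.not_gt hx h
    rw [ih (C.erase m) (by rw [Finset.card_erase_of_mem hm]; omega) (by
      intro x y z hxy hyz hx hz
      refine Finset.mem_erase.2 ⟨?_, hC x y z hxy hyz (Finset.mem_of_mem_erase hx)
        (Finset.mem_of_mem_erase hz)⟩
      rintro rfl
      exact hmax' z (Finset.mem_of_mem_erase hz) hyz)]
    rw [mu_point (↑(C.erase m) : Set α)ᶜ m (by simp)]
    have e1 : (↑(C.erase m) : Set α)ᶜ \ {m} = (↑C : Set α)ᶜ := by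
      ext a
      simp only [Set.mem_sdiff, Set.mem_compl_iff, Finset.mem_coe, Finset.mem_erase,
        Set.mem_singleton_iff]
      constructor
      · rintro ⟨h2, h3⟩
        exact fun h => h2 ⟨h3, h⟩
      · rintro h2
        exact ⟨fun h => h2 h.2, fun h => h2 (h ▸ hm)⟩
    have e2 : {a | a ∈ (↑(C.erase m) : Set α)ᶜ ∧ m < a} = {a | m < a} := by
      ext a
      simp only [Set.mem_ofPred_eq, Set.mem_compl_iff, Finset.mem_coe, Finset.mem_erase]
      exact ⟨fun h => h.2, fun h => ⟨fun h' => hmax' a h'.2 h, h⟩⟩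
    have e3 : {a | a ∈ (↑(C.erase m) : Set α)ᶜ ∧ a < m}
        = {a | a < m} \ ↑(C.filter (· < m)) := by
      ext a
      simp only [Set.mem_ofPred_eq, Set.mem_compl_iff, Finset.mem_coe, Finset.mem_erase,
        Set.mem_sdiff, Finset.mem_filter]
      constructor
      · rintro ⟨h1, h2⟩
        exact ⟨h2, fun h => h1 ⟨h2.ne, h.1⟩⟩
      · rintro ⟨h1, h2⟩
        exact ⟨fun h => h2 ⟨h.2, h1⟩, h1⟩
    have key := mu_upper {a | a < m} _ (C.filter (· < m)) rfl
      (fun x hx => (Finset.mem_filter.1 hx).2)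
      (fun x hx y hy hxy => Finset.mem_filter.2
        ⟨hC x y m hxy hy (Finset.mem_filter.1 hx).1 hm, hy⟩)
    have e4 : ∑ x ∈ C.filter (· < m), mu α {a | a ∈ {a | a < m} ∧ a < x}
        = ∑ x ∈ C.filter (· < m), mu α {a | a < x} := by
      apply Finset.sum_congr rfl
      intro x hx
      congr 1
      ext a
      exact ⟨fun h => h.2, fun h => ⟨lt_trans h (Finset.mem_filter.1 hx).2, h⟩⟩
    have e5 : C.filter (· ≤ m) = insert m (C.filter (· < m)) := by
      ext a
      simp only [Finset.mem_insert, Finset.mem_filter]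
      constructor
      · rintro ⟨h1, h2⟩
        rcases h2.eq_or_lt with h | h
        · exact Or.inl h
        · exact Or.inr ⟨h1, h⟩
      · rintro (rfl | h)
        · exact ⟨hm, le_rfl⟩
        · exact ⟨h.1, h.2.le⟩
    have e6 : ∑ y ∈ C.erase m, (∑ x ∈ (C.erase m).filter (· ≤ y), mu α {a | a < x})
          * mu α {b | y < b}
        = ∑ y ∈ C.erase m, (∑ x ∈ C.filter (· ≤ y), mu α {a | a < x}) * mu α {b | y < b} := by
      apply Finset.sum_congr rfl
      intro y hy
      congr 2
      ext a
      simp only [Finset.mem_filter, Finset.mem_erase] at hy ⊢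
      constructor
      · rintro ⟨h1, h2⟩
        exact ⟨h1.2, h2⟩
      · rintro ⟨h1, h2⟩
        refine ⟨⟨?_, h1⟩, h2⟩
        rintro rfl
        exact hmax' y hy.2 (lt_of_le_of_ne h2 (Ne.symm hy.1))
    rw [e4] at key
    rw [e1, e2, e3, e6, ← Finset.add_sum_erase C _ hm, e5, Finset.sum_insert (by simp), key]
    ring

/-- (Björner–Walker) For a finite poset `P` and a convex subset `C ⊆ P`,
`μ(P) = μ(P∖C) + ∑_{x,y ∈ C, x ≤ y} μ(Û_x)·μ(F̂_y)`. -/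
theorem stmt15 {α : Type*} [PartialOrder α] [Fintype α] (C : Set α)
    (hC : ∀ x y z : α, x < y → y < z → x ∈ C → z ∈ C → y ∈ C) :
    mu α Set.univ =
      mu α Cᶜ +
        ∑ p ∈ Finset.univ.filter (fun p : α × α => p.1 ∈ C ∧ p.2 ∈ C ∧ p.1 ≤ p.2),
          mu α {a | a < p.1} * mu α {b | p.2 < b} := by
  rw [mu_conv _ C.toFinset rfl (by simpa using hC), Set.coe_toFinset]
  congr 1
  rw [Finset.sum_filter, Fintype.sum_prod_type_right]
  simp only [Finset.sum_mul, Finset.sum_filter]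
  rw [← Finset.sum_filter_add_sum_filter_not Finset.univ (fun y => y ∈ C)]
  rw [Finset.sum_eq_zero (s := Finset.univ.filter (fun y => ¬ y ∈ C)), add_zero]
  · apply Finset.sum_congr
    · ext; simp
    intro y hy
    have hy : y ∈ C := by simpa using hy
    simp only [ite_mul, zero_mul]
    rw [← Finset.sum_filter, ← Finset.sum_filter]
    apply Finset.sum_congr _ (fun _ _ => rfl)
    ext a
    simp [hy]
  · intro y hy
    have hy : y ∉ C := by simpa using hy
    simp [hy]
end

section
/- Let X be a finite, connected T₀ topological space. Suppose there exist a nonempty proper subset A ⊊ X and an integer n ≥ 2 such that every connected component of A (with the subspace topology) is n-connected (nonempty, path-connected, and with trivial k-th homotopy group for all 1 ≤ k ≤ n), and such that for every connected component B of X∖A (with the subspace topology) and every b ∈ B, the homomorphism π₁(B, b) → π₁(X, b) induced by the inclusion is trivial. Then for every x₀ ∈ X the fundamental group π₁(X, x₀) is a free group. -/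
open CategoryTheory Topology Set unitInterval

namespace FinFree
universe u
variable {X : Type u} [TopologicalSpace X]

/-- comparability -/
def Cmp (x y : X) : Prop := x ⤳ y ∨ y ⤳ x

lemma Cmp.symm {x y : X} (h : Cmp x y) : Cmp y x := Or.symm h
lemma Cmp.refl (x : X) : Cmp x x := Or.inl specializes_rfl

lemma contractible_of_top {Y : Type*} [TopologicalSpace Y] (m : Y) (h : ∀ y, y ⤳ m) :
    ContractibleSpace Y := by
  rw [contractible_iff_id_nullhomotopic]
  refine ⟨m, ⟨⟨⟨fun p => if p.1 = 1 then m else p.2, ?_⟩, ?_, ?_⟩⟩⟩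
  · rw [continuous_def]
    intro U hU
    by_cases hm : m ∈ U
    · convert isOpen_univ
      ext p
      simp only [mem_preimage, mem_univ, iff_true]
      split_ifs
      · exact hm
      · exact (h p.2).mem_open hU hm
    · have : (fun p : I × Y => if p.1 = 1 then m else p.2) ⁻¹' U = {p | p.1 ≠ 1} ∩ Prod.snd ⁻¹' U := by
        ext p
        by_cases hp : p.1 = 1 <;> simp [hp, hm]
      rw [this]
      exact (isOpen_ne.preimage continuous_fst).inter (hU.preimage continuous_snd)
  · intro y; simp
  · intro y; simp

/-- two paths in the minimal neighbourhood of `m` are homotopic. -/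
lemma homotopic_of_mem {m x y : X} (p q : Path x y) (hp : ∀ t, p t ⤳ m) (hq : ∀ t, q t ⤳ m) :
    p.Homotopic q := by
  let N : Set X := {z | z ⤳ m}
  have hx : x ∈ N := by have := hp 0; rwa [p.source] at this
  have hy : y ∈ N := by have := hp 1; rwa [p.target] at this
  have : ContractibleSpace N := contractible_of_top ⟨m, specializes_rfl⟩
    (fun z => by rw [subtype_specializes_iff]; exact z.2)
  let p' : Path (⟨x, hx⟩ : N) ⟨y, hy⟩ :=
    { toFun := fun t => ⟨p t, hp t⟩
      continuous_toFun := by fun_prop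
      source' := by simp
      target' := by simp }
  let q' : Path (⟨x, hx⟩ : N) ⟨y, hy⟩ :=
    { toFun := fun t => ⟨q t, hq t⟩
      continuous_toFun := by fun_prop
      source' := by simp
      target' := by simp }
  have := (SimplyConnectedSpace.paths_homotopic p' q').map ⟨Subtype.val, continuous_subtype_val⟩
  exact this

lemma exists_edge {x y : X} (h : Cmp x y) : ∃ p : Path x y, ∀ t, p t = x ∨ p t = y := by
  have : JoinedIn ({x, y} : Set X) x y := by
    rcases h with h | h
    · exact h.joinedIn (by simp) (by simp)
    · exact (h.joinedIn (F := {x, y}) (by simp) (by simp)).symm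
  exact ⟨this.somePath, fun t => this.somePath_mem t⟩

noncomputable def ep {x y : X} (h : Cmp x y) : Path x y := (exists_edge h).choose

lemma ep_mem {x y : X} (h : Cmp x y) (t) : ep h t = x ∨ ep h t = y := (exists_edge h).choose_spec t

lemma ep_le {x y m : X} (h : Cmp x y) (hx : x ⤳ m) (hy : y ⤳ m) (t) : ep h t ⤳ m := by
  rcases ep_mem h t with h | h <;> rw [h] <;> assumption

abbrev o (x : X) : FundamentalGroupoid X := FundamentalGroupoid.mk x

abbrev cls {x y : X} (p : Path x y) : o x ⟶ o y := Path.Homotopic.Quotient.mk p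

lemma cls_eq {x y : X} {p q : Path x y} : cls p = cls q ↔ p.Homotopic q :=
  Path.Homotopic.Quotient.eq

lemma cls_trans {x y z : X} (p : Path x y) (q : Path y z) : cls (p.trans q) = cls p ≫ cls q := rfl

lemma cls_symm {x y : X} (p : Path x y) : cls (p.symm) = inv (cls p) := by
  rw [← Groupoid.inv_eq_inv]; rfl

lemma cls_surj {x y : X} (γ : o x ⟶ o y) : ∃ p : Path x y, cls p = γ :=
  Path.Homotopic.Quotient.mk_surjective γ

noncomputable def e {x y : X} (h : Cmp x y) : o x ⟶ o y := cls (ep h)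

lemma trans_mem {x y z : X} (p : Path x y) (q : Path y z) (P : X → Prop) (hp : ∀ t, P (p t))
    (hq : ∀ t, P (q t)) (t) : P (p.trans q t) := by
  have : p.trans q t ∈ range (p.trans q) := ⟨t, rfl⟩
  rw [Path.trans_range] at this
  rcases this with ⟨s, hs⟩ | ⟨s, hs⟩ <;> rw [← hs]
  · exact hp s
  · exact hq s

lemma exists_top {x y z : X} (hxy : Cmp x y) (hyz : Cmp y z) (hxz : Cmp x z) :
    ∃ m, x ⤳ m ∧ y ⤳ m ∧ z ⤳ m := by
  rcases hxy with h1 | h1 <;> rcases hyz with h2 | h2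
  · exact ⟨z, h1.trans h2, h2, specializes_rfl⟩
  · exact ⟨y, h1, specializes_rfl, h2⟩
  · rcases hxz with h3 | h3
    · exact ⟨z, h3, h2, specializes_rfl⟩
    · exact ⟨x, specializes_rfl, h1, h3⟩
  · exact ⟨x, specializes_rfl, h1, h2.trans h1⟩

lemma e_tri {x y z : X} (hxy : Cmp x y) (hyz : Cmp y z) (hxz : Cmp x z) :
    e hxy ≫ e hyz = e hxz := by
  obtain ⟨m, hx, hy, hz⟩ := exists_top hxy hyz hxz
  rw [e, e, e, ← cls_trans, cls_eq]
  exact homotopic_of_mem (m := m) _ _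
    (trans_mem _ _ (· ⤳ m) (ep_le _ hx hy) (ep_le _ hy hz)) (ep_le _ hx hz)

lemma e_refl {x : X} (h : Cmp x x) : e h = 𝟙 _ := by
  change _ = cls (Path.refl x)
  rw [e, cls_eq]
  exact homotopic_of_mem (m := x) _ _ (ep_le _ specializes_rfl specializes_rfl)
    (fun t => specializes_rfl)

lemma e_symm {x y : X} (h : Cmp x y) : e h.symm = inv (e h) := by
  rw [eq_comm, IsIso.inv_eq_of_hom_inv_id]
  rw [e_tri h h.symm (Cmp.refl x), e_refl]

lemma isOpen_N [Finite X] (m : X) : IsOpen {z : X | z ⤳ m} := by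
  convert isOpen_nhdsKer (s := ({m} : Set X))
  ext z; simp

/-- generation -/
lemma gen [Finite X] (P : ∀ x y : X, (o x ⟶ o y) → Prop)
    (he : ∀ x y (h : Cmp x y), P x y (e h))
    (hc : ∀ x y z (f : o x ⟶ o y) (g : o y ⟶ o z), P x y f → P y z g → P x z (f ≫ g))
    {x y : X} (γ : o x ⟶ o y) : P x y γ := by
  obtain ⟨p, rfl⟩ := cls_surj γ
  obtain ⟨t, t0, tm, ⟨n, hn⟩, ht⟩ := exists_monotone_Icc_subset_open_cover_unitInterval
    (c := fun m : X => p ⁻¹' {z | z ⤳ m}) (fun m => (isOpen_N m).preimage p.continuous)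
    (fun s _ => mem_iUnion.2 ⟨p s, specializes_rfl⟩)
  have key : ∀ k, P (p (t 0)) (p (t k)) (cls (p.subpath (t 0) (t k))) := by
    intro k
    induction k with
    | zero =>
      rw [Path.subpath_self]
      have := he (p (t 0)) _ (Cmp.refl _)
      rwa [e_refl] at this
    | succ k ih =>
      rw [← cls_eq.2 ⟨Path.Homotopy.subpathTransSubpath p (t 0) (t k) (t (k+1))⟩, cls_trans]
      refine hc _ _ _ _ _ ih ?_
      obtain ⟨m, hm⟩ := ht k
      have hle := tm (Nat.le_succ k)
      have h1 : p (t k) ⤳ m := hm ⟨le_rfl, hle⟩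
      have h2 : p (t (k+1)) ⤳ m := hm ⟨hle, le_rfl⟩
      have hs : ∀ s, p.subpath (t k) (t (k+1)) s ⤳ m := by
        intro s
        have : p.subpath (t k) (t (k+1)) s ∈ range (p.subpath (t k) (t (k+1))) := ⟨s, rfl⟩
        rw [Path.range_subpath_of_le _ _ _ hle] at this
        obtain ⟨r, hr, hr'⟩ := this
        rw [← hr']; exact hm hr
      have h1' : Cmp (p (t k)) m := Or.inl h1
      have h2' : Cmp m (p (t (k+1))) := Or.inr h2
      have : cls (p.subpath (t k) (t (k+1))) = e h1' ≫ e h2' := by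
        rw [e, e, ← cls_trans, cls_eq]
        exact homotopic_of_mem (m := m) _ _ hs
          (trans_mem _ _ (· ⤳ m) (ep_le _ h1 specializes_rfl) (ep_le _ specializes_rfl h2))
      rw [this]
      exact hc _ _ _ _ _ (he _ _ _) (he _ _ _)
  have := key n
  rw [t0, hn n le_rfl, Path.subpath_zero_one] at this
  have aux : ∀ {x' y' : X} (hx : x' = x) (hy : y' = y), P x' y' (cls (p.cast hx hy)) →
    P x y (cls p) := by
    rintro _ _ rfl rfl h; exact h
  exact aux _ _ this


/-- multiplicative cocycles on comparable triples -/
def Coc {H : Type u} [Group H] (k : X → X → H) : Prop :=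
  ∀ x y z, Cmp x y → Cmp y z → Cmp x z → k x z = k y z * k x y

lemma Coc.self {H : Type u} [Group H] {k : X → X → H} (hk : Coc k) (x : X) : k x x = 1 := by
  have := hk x x x (Cmp.refl x) (Cmp.refl x) (Cmp.refl x)
  simpa using this

section lift
variable [Finite X] {H : Type u} [Group H] [TopologicalSpace H] [DiscreteTopology H]

/-- the bundle -/
def core (k : X → X → H) (hk : Coc k) : FiberBundleCore X X H where
  baseSet m := {z | z ⤳ m}
  isOpen_baseSet := isOpen_N
  indexAt := id
  mem_baseSet_at x := specializes_rfl
  coordChange i j y h := (k j y)⁻¹ * k i y * h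
  coordChange_self i x _ v := by simp
  coordChange_comp i j l x _ v := by group
  continuousOn_coordChange i j := by
    rintro ⟨y, h⟩ ⟨⟨hi, hj⟩, -⟩
    apply ContinuousAt.continuousWithinAt
    have h1 : {p : X × H | p.1 ⤳ y ∧ p.2 = h} ∈ 𝓝 (y, h) := by
      apply IsOpen.mem_nhds
      · exact ((isOpen_N y).preimage continuous_fst).inter
          ((isOpen_discrete {h}).preimage continuous_snd)
      · exact ⟨specializes_rfl, rfl⟩
    refine (continuousAt_const (y := (k j y)⁻¹ * k i y * h)).congr ?_
    filter_upwards [h1]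
    rintro ⟨z, h'⟩ ⟨hz, rfl⟩
    simp only [mem_ofPred_eq] at hi hj hz
    dsimp only
    rw [hk i y z (Or.inr hi) (Or.inr hz) (Or.inr (hz.trans hi)),
      hk j y z (Or.inr hj) (Or.inr hz) (Or.inr (hz.trans hj))]
    group

lemma core_cov (k : X → X → H) (hk : Coc k) :
    IsCoveringMap (Bundle.TotalSpace.proj : (core k hk).TotalSpace → X) :=
  FiberBundle.isCoveringMap

/-- points of the total space -/
def pt (k : X → X → H) (hk : Coc k) (x : X) (h : H) : (core k hk).TotalSpace := ⟨x, h⟩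

/-- points of a fibre -/
def fpt (k : X → X → H) (hk : Coc k) (x : X) (h : H) :
    (Bundle.TotalSpace.proj : (core k hk).TotalSpace → X) ⁻¹' {x} := ⟨pt k hk x h, rfl⟩

lemma fpt_inj (k : X → X → H) (hk : Coc k) (x : X) {h h' : H}
    (hh : fpt k hk x h = fpt k hk x h') : h = h' := by
  have := congrArg Subtype.val hh
  simp only [fpt, pt] at this
  injection this

/-- monodromy at the level of `H` -/
noncomputable def mono (k : X → X → H) (hk : Coc k) {x y : X} (γ : o x ⟶ o y) (h : H) : H :=
  ((core_cov k hk).monodromy γ (fpt k hk x h)).1.2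

lemma monodromy_eq (k : X → X → H) (hk : Coc k) {x y : X} (γ : o x ⟶ o y) (h : H) :
  (core_cov k hk).monodromy γ (fpt k hk x h) = fpt k hk y (mono k hk γ h) := by
  unfold mono
  generalize (core_cov k hk).monodromy γ (fpt k hk x h) = a
  obtain ⟨⟨a, b⟩, hh⟩ := a
  obtain rfl : a = y := hh
  rfl

lemma mono_comp (k : X → X → H) (hk : Coc k) {x y z : X} (f : o x ⟶ o y) (g : o y ⟶ o z) (h : H) :
    mono k hk (f ≫ g) h = mono k hk g (mono k hk f h) := by
  have := (core_cov k hk).monodromy_trans_apply f g (fpt k hk x h)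
  rw [monodromy_eq k hk f h, monodromy_eq k hk g] at this
  exact fpt_inj k hk _ ((monodromy_eq k hk (f ≫ g) h).symm.trans this)

lemma mono_id (k : X → X → H) (hk : Coc k) {x : X} (h : H) :
    mono k hk (𝟙 (o x)) h = h := by
  have := congrFun ((core_cov k hk).monodromy_refl (x := x)) (fpt k hk x h)
  have h2 := monodromy_eq k hk (𝟙 (o x)) h
  have h3 := h2.symm.trans this
  exact fpt_inj k hk _ h3

/-- monodromy along a path in the minimal nbhd of `m`-/
lemma mono_of_mem (k : X → X → H) (hk : Coc k) {x y m : X} (p : Path x y) (hp : ∀ t, p t ⤳ m)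
    (h : H) : mono k hk (cls p) h = k m y * (k m x)⁻¹ * h := by
  let Z := core k hk
  let Γ : Path (pt k hk x h) (pt k hk y (k m y * (k m x)⁻¹ * h)) :=
    { toFun := fun t => (Z.localTrivAsPartialEquiv m).symm (p t, (k m x)⁻¹ * h)
      continuous_toFun := by
        have h1 : ContinuousOn (Z.localTriv m).toOpenPartialHomeomorph.symm (Z.localTriv m).target :=
          (Z.localTriv m).toOpenPartialHomeomorph.continuousOn_symm
        refine h1.comp_continuous (f := fun t : I => (p t, (k m x)⁻¹ * h)) (by fun_prop) ?_
        intro t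
        exact ⟨hp t, trivial⟩
      source' := by
        change (⟨p 0, (k (p 0) (p 0))⁻¹ * k m (p 0) * ((k m x)⁻¹ * h)⟩ : Z.TotalSpace) = _
        rw [hk.self, p.source]; simp [pt]
      target' := by
        change (⟨p 1, (k (p 1) (p 1))⁻¹ * k m (p 1) * ((k m x)⁻¹ * h)⟩ : Z.TotalSpace) = _
        rw [hk.self, p.target]; simp [pt, mul_assoc] }
  have := (core_cov k hk).monodromy_map (cls Γ)
  have h2 := monodromy_eq k hk (cls p) h
  have h3 := h2.symm.trans this
  exact fpt_inj k hk _ h3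

lemma mono_e (k : X → X → H) (hk : Coc k) {x y : X} (hxy : Cmp x y)
    (h : H) : mono k hk (e hxy) h = k x y * h := by
  obtain ⟨m, hx, hy, -⟩ := exists_top hxy (Cmp.refl y) hxy
  rw [e, mono_of_mem k hk _ (ep_le hxy hx hy), hk m x y (Or.inr hx) hxy (Or.inr hy)]
  group

lemma mono_mul (k : X → X → H) (hk : Coc k) {x y : X} (γ : o x ⟶ o y) :
    ∀ h, mono k hk γ h = mono k hk γ 1 * h := by
  refine gen (fun x y γ => ∀ h, mono k hk γ h = mono k hk γ 1 * h) ?_ ?_ γ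
  · intro x y hxy h
    rw [mono_e, mono_e]; simp
  · intro x y z f g hf hg h
    rw [mono_comp, mono_comp, hg, hf, hg (mono k hk f 1), mul_assoc]

end lift

lemma exists_functor [Finite X] {H : Type u} [Group H] (k : X → X → H) (hk : Coc k) :
    ∃ F : FundamentalGroupoid X ⥤ SingleObj H, ∀ x y (h : Cmp x y), F.map (e h) = k x y := by
  let _ : TopologicalSpace H := ⊥
  have : DiscreteTopology H := ⟨rfl⟩
  refine ⟨{ obj := fun _ => SingleObj.star H
            map := fun {a b} γ => mono k hk (x := a.as) (y := b.as) γ 1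
            map_id := fun a => mono_id k hk (x := a.as) 1
            map_comp := fun {a b c} f g => ?_ }, ?_⟩
  · rw [SingleObj.comp_as_mul]
    have := mono_comp k hk (x := a.as) (y := b.as) (z := c.as) f g 1
    rw [mono_mul k hk (x := b.as) (y := c.as) g] at this
    exact this
  · intro x y h
    have := mono_e k hk h 1
    rw [mul_one] at this
    exact this


/-- composites of edges staying on one side of `A` -/
inductive SP (A : Set X) : ∀ x y : X, (o x ⟶ o y) → Prop
  | id (x : X) : SP A x x (𝟙 _)
  | cons {x y z : X} {γ : o x ⟶ o y} (h : SP A x y γ) (hc : Cmp y z) (hs : y ∈ A ↔ z ∈ A) :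
      SP A x z (γ ≫ e hc)

section side
variable {A : Set X}

lemma SP.single {x y : X} (hc : Cmp x y) (hs : x ∈ A ↔ y ∈ A) : SP A x y (e hc) := by
  have := SP.cons (SP.id x) hc hs
  rwa [Category.id_comp] at this

lemma SP.trans {x y z : X} {f : o x ⟶ o y} {g : o y ⟶ o z} (hf : SP A x y f) (hg : SP A y z g) :
    SP A x z (f ≫ g) := by
  induction hg with
  | id => rwa [Category.comp_id]
  | cons h hc hs ih =>
    rw [← Category.assoc]
    exact SP.cons ih hc hs

lemma SP.symm {x y : X} {f : o x ⟶ o y} (hf : SP A x y f) : SP A y x (inv f) := by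
  induction hf with
  | id => rw [IsIso.inv_id]; exact SP.id _
  | cons h hc hs ih =>
    rw [IsIso.inv_comp, ← e_symm]
    exact (SP.single hc.symm hs.symm).trans ih

lemma SP.rep {x y : X} {f : o x ⟶ o y} (hf : SP A x y f) :
    ∃ p : Path x y, cls p = f ∧ ∀ t, (p t ∈ A ↔ x ∈ A) := by
  induction hf with
  | id => exact ⟨Path.refl x, rfl, fun t => Iff.rfl⟩
  | @cons y z γ h hc hs ih =>
    obtain ⟨p, rfl, hp⟩ := ih
    refine ⟨p.trans (ep hc), rfl, trans_mem _ _ (fun a => a ∈ A ↔ x ∈ A) hp ?_⟩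
    have hy : y ∈ A ↔ x ∈ A := by have := hp 1; rwa [p.target] at this
    intro t
    rcases ep_mem hc t with h | h <;> rw [h]
    · exact hy
    · exact hs.symm.trans hy

/-- loops on one side of `A` are trivial -/
def Loops (A : Set X) : Prop :=
  ∀ x (p : Path x x), (∀ t, p t ∈ A ↔ x ∈ A) → p.Homotopic (Path.refl x)

lemma SP.unique (hL : Loops A) {x y : X} {f g : o x ⟶ o y} (hf : SP A x y f) (hg : SP A x y g) :
    f = g := by
  obtain ⟨p, hp, hp'⟩ := (hf.trans hg.symm).rep
  have : f ≫ inv g = 𝟙 _ := by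
    rw [← hp]
    exact cls_eq.2 (hL x p hp')
  rwa [IsIso.comp_inv_eq, Category.id_comp] at this

variable (A) in
/-- same component of a side -/
def S (x y : X) : Prop := ∃ f, SP A x y f

lemma S.trans {x y z : X} (h : S A x y) (h' : S A y z) : S A x z :=
  ⟨_, h.choose_spec.trans h'.choose_spec⟩
lemma S.symm {x y : X} (h : S A x y) : S A y x := ⟨_, h.choose_spec.symm⟩
lemma S.refl (x : X) : S A x x := ⟨_, SP.id x⟩
lemma S.single {x y : X} (hc : Cmp x y) (hs : x ∈ A ↔ y ∈ A) : S A x y := ⟨_, SP.single hc hs⟩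

noncomputable def w {x y : X} (h : S A x y) : o x ⟶ o y := h.choose

lemma w_sp {x y : X} (h : S A x y) : SP A x y (w h) := h.choose_spec

lemma w_comp (hL : Loops A) {x y z : X} (h : S A x y) (h' : S A y z) (h'' : S A x z) :
    w h ≫ w h' = w h'' := ((w_sp h).trans (w_sp h')).unique hL (w_sp h'')

lemma w_id (hL : Loops A) {x : X} (h : S A x x) : w h = 𝟙 _ := (w_sp h).unique hL (SP.id x)

lemma w_e (hL : Loops A) {x y : X} (hc : Cmp x y) (hs : x ∈ A ↔ y ∈ A) (h : S A x y) :
    w h = e hc := (w_sp h).unique hL (SP.single hc hs)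

variable (A) in
def sS : Setoid X := ⟨S A, S.refl, S.symm, S.trans⟩

variable (A) in
noncomputable def r (x : X) : X := (Quotient.mk (sS A) x).out

lemma r_S (x : X) : S A (r A x) x := Quotient.exact (s := sS A) (Quotient.out_eq _)

lemma r_eq {x y : X} (h : S A x y) : r A x = r A y := by
  unfold r
  rw [Quotient.sound (s := sS A) h]

variable (A) in
/-- crossing edges -/
def Cross : Type u := {p : X × X // p.1 ∈ A ∧ p.2 ∉ A ∧ Cmp p.1 p.2}

noncomputable def Cross.e (p : Cross A) : o p.1.1 ⟶ o p.1.2 := FinFree.e p.2.2.2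

def crossS (hL : Loops A) : Setoid (Cross A) where
  r p q := ∃ (h1 : S A p.1.1 q.1.1) (h2 : S A q.1.2 p.1.2), p.e = w h1 ≫ q.e ≫ w h2
  iseqv :=
    { refl := fun p => ⟨S.refl _, S.refl _, by simp [w_id hL]⟩
      symm := by
        rintro p q ⟨h1, h2, h⟩
        refine ⟨h1.symm, h2.symm, ?_⟩
        rw [h, Category.assoc, Category.assoc, w_comp hL h2 h2.symm (S.refl _), w_id hL,
          Category.comp_id, ← Category.assoc, w_comp hL h1.symm h1 (S.refl _), w_id hL,
          Category.id_comp]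
      trans := by
        rintro p q s ⟨h1, h2, h⟩ ⟨h1', h2', h'⟩
        refine ⟨h1.trans h1', h2'.trans h2, ?_⟩
        rw [h, h', ← w_comp hL h1 h1', ← w_comp hL h2' h2]
        simp only [Category.assoc] }

lemma cross_rel (hL : Loops A) (p q : Cross A) (h1 : Cmp p.1.1 q.1.1) (h2 : Cmp q.1.2 p.1.2)
    (h3 : Cmp p.1.1 q.1.2) : (crossS hL).r p q := by
  have s1 : p.1.1 ∈ A ↔ q.1.1 ∈ A := by simp [p.2.1, q.2.1]
  have s2 : q.1.2 ∈ A ↔ p.1.2 ∈ A := by simp [p.2.2.1, q.2.2.1]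
  refine ⟨S.single h1 s1, S.single h2 s2, ?_⟩
  rw [w_e hL h1 s1, w_e hL h2 s2, Cross.e, Cross.e, ← Category.assoc, e_tri h1 q.2.2.2 h3,
    e_tri]

/-- free generators -/
inductive Gen (hL : Loops A) : X → X → Type u
  | tree (y : X) (h : r A y ≠ y) : Gen hL (r A y) y
  | cross (c : Quotient (crossS hL)) : Gen hL c.out.1.1 c.out.1.2

noncomputable def Gen.of {hL : Loops A} : ∀ {x y : X}, Gen hL x y → (o x ⟶ o y)
  | _, _, .tree y _ => w (r_S y)
  | _, _, .cross c => c.out.e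

section
variable [Finite X] {H : Type u} [Group H] {hL : Loops A} (f : ∀ x y : X, Gen hL x y → H)

open Classical in
noncomputable def tt (y : X) : H := if h : r A y ≠ y then f _ _ (.tree y h) else 1

noncomputable def KK (c : Quotient (crossS hL)) : H :=
  (tt f c.out.1.2)⁻¹ * f _ _ (.cross c) * tt f c.out.1.1

open Classical in
noncomputable def K2 (x y : X) : H :=
  if h : x ∈ A ∧ y ∉ A ∧ Cmp x y then KK f (Quotient.mk _ ⟨(x, y), h⟩) else 1

open Classical in
noncomputable def kap (x y : X) : H :=
  if x ∈ A then (if y ∈ A then 1 else K2 f x y) else (if y ∈ A then (K2 f y x)⁻¹ else 1)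

lemma K2_eq {x y x' y' : X} (hx : x ∈ A) (hy : y ∉ A) (hx' : x' ∈ A) (hy' : y' ∉ A)
    (hc : Cmp x y) (hc' : Cmp x' y') (h1 : Cmp x x') (h2 : Cmp y' y) (h3 : Cmp x y') :
    K2 f x y = K2 f x' y' := by
  rw [K2, K2, dif_pos ⟨hx, hy, hc⟩, dif_pos ⟨hx', hy', hc'⟩]
  congr 1
  apply Quotient.sound (s := crossS hL)
  exact cross_rel hL _ _ h1 h2 h3

lemma kap_coc : Coc (kap f) := by
  intro x y z hxy hyz hxz
  unfold kap
  by_cases hx : x ∈ A <;> by_cases hy : y ∈ A <;> by_cases hz : z ∈ A <;>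
    simp only [hx, hy, hz, if_true, if_false, mul_one, one_mul]
  · exact K2_eq f hx hz hy hz hxz hyz hxy (Cmp.refl _) hxz
  · rw [K2_eq f hx hy hz hy hxy hyz.symm hxz (Cmp.refl _) hxy]; simp
  · exact K2_eq f hx hz hx hy hxz hxy (Cmp.refl _) hyz hxy
  · rw [K2_eq f hz hx hy hx hxz.symm hxy.symm hyz.symm (Cmp.refl _) hxz.symm]
  · rw [K2_eq f hy hx hy hz hxy.symm hyz (Cmp.refl _) hxz.symm hyz]; simp
  · rw [K2_eq f hz hx hz hy hxz.symm hyz.symm (Cmp.refl _) hxy.symm hyz.symm]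

lemma exists_lift : ∃ F : FundamentalGroupoid X ⥤ SingleObj H,
    ∀ x y (g : Gen hL x y), F.map g.of = f x y g := by
  have hk : Coc (fun x y => tt f y * kap f x y * (tt f x)⁻¹) := by
    intro x y z hxy hyz hxz
    dsimp only
    rw [kap_coc f x y z hxy hyz hxz]
    group
  obtain ⟨F, hF⟩ := exists_functor _ hk
  have hsp : ∀ x y (γ : o x ⟶ o y), SP A x y γ → F.map γ = tt f y * (tt f x)⁻¹ := by
    intro x y γ h
    induction h with
    | id => rw [F.map_id, mul_inv_cancel]; rfl
    | @cons y z γ h hc hs ih =>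
      rw [F.map_comp, SingleObj.comp_as_mul, ih, hF]
      have : kap f y z = 1 := by
        unfold kap
        by_cases hy : y ∈ A
        · simp [hy, hs.1 hy]
        · have hz : z ∉ A := fun hz => hy (hs.2 hz)
          simp [hy, hz]
      rw [this]; group
  refine ⟨F, ?_⟩
  intro x y g
  rcases g with ⟨_, h⟩ | c
  · have := hsp _ _ _ (w_sp (r_S (A := A) y))
    rw [Gen.of, this]
    have h1 : tt f y = f _ _ (.tree y h) := by rw [tt, dif_pos h]
    have h2 : tt f (r A y) = 1 := by
      rw [tt, dif_neg]
      rw [not_not]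
      exact r_eq (r_S y)
    rw [h1, h2]; simp
  · rw [Gen.of, Cross.e, hF]
    have h1 : kap f c.out.1.1 c.out.1.2 = KK f c := by
      unfold kap
      rw [if_pos c.out.2.1, if_neg c.out.2.2.1, K2, dif_pos c.out.2]
      congr 1
      exact Quotient.out_eq c
    rw [h1, KK]
    group

lemma lift_unique (F G : FundamentalGroupoid X ⥤ SingleObj H)
    (h : ∀ x y (g : Gen hL x y), (F.map g.of : H) = G.map g.of) : F = G := by
  have tree : ∀ y, (F.map (w (r_S (A := A) y)) : H) = G.map (w (r_S (A := A) y)) := by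
    intro y
    by_cases hy : r A y = y
    · have : ∀ z (hz : z = y) (hS : S A z y), (F.map (w hS) : H) = G.map (w hS) := by
        rintro _ rfl hS
        rw [w_id hL, F.map_id, G.map_id]
        rfl
      exact this _ hy _
    · exact h _ _ (.tree y hy)
  have tree' : ∀ z y (hz : z = r A y) (hS : S A z y), (F.map (w hS) : H) = G.map (w hS) := by
    rintro _ y rfl hS
    exact tree y
  have side : ∀ x y (hS : S A x y), (F.map (w hS) : H) = G.map (w hS) := by
    intro x y hS
    have h1 := w_comp hL (r_S x) hS ((r_S x).trans hS)
    have h2 : (F.map (w (r_S (A := A) x) ≫ w hS) : H) = G.map (w (r_S (A := A) x) ≫ w hS) := by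
      rw [h1]
      exact tree' _ _ (r_eq hS) _
    rw [F.map_comp, G.map_comp, SingleObj.comp_as_mul, SingleObj.comp_as_mul] at h2
    have h3 := tree x
    rw [h3] at h2
    exact mul_right_cancel h2
  have cross : ∀ p : Cross A, (F.map p.e : H) = G.map p.e := by
    intro p
    obtain ⟨h1, h2, h3⟩ := (crossS hL).symm (Quotient.mk_out (s := crossS hL) p)
    rw [h3]
    have := h _ _ (.cross (Quotient.mk (crossS hL) p))
    rw [Gen.of] at this
    rw [F.map_comp, G.map_comp, F.map_comp, G.map_comp]
    simp only [SingleObj.comp_as_mul]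
    have a1 := side _ _ h1
    have a2 := side _ _ h2
    exact congr_arg₂ (· * · : H → H → H) (congr_arg₂ (· * · : H → H → H) a2 this) a1
  have edge : ∀ x y (hc : Cmp x y), (F.map (e hc) : H) = G.map (e hc) := by
    intro x y hc
    by_cases hs : x ∈ A ↔ y ∈ A
    · rw [← w_e hL hc hs (S.single hc hs)]
      exact side _ _ _
    · by_cases hx : x ∈ A
      · exact cross ⟨(x, y), hx, fun hy => hs (by simp [hx, hy]), hc⟩
      · have hy : y ∈ A := by by_contra hy; exact hs (by simp [hx, hy])
        have := cross ⟨(y, x), hy, hx, hc.symm⟩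
        have h2 : e hc = inv (e hc.symm) := e_symm hc.symm
        rw [h2, F.map_inv, G.map_inv, SingleObj.inv_as_inv, SingleObj.inv_as_inv]
        exact congr_arg (·⁻¹ : H → H) this
  have all : ∀ x y (γ : o x ⟶ o y), (F.map γ : H) = G.map γ := by
    intro x y γ
    refine gen (fun x y γ => (F.map γ : H) = G.map γ) edge ?_ γ
    intro x y z f g hf hg
    rw [F.map_comp, G.map_comp]
    exact congr_arg₂ (· * · : H → H → H) hg hf
  refine Functor.hext (fun _ => rfl) ?_
  intro a b γ
  exact heq_of_eq (all a.as b.as γ)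

end

@[reducible]
noncomputable def free [Finite X] (hL : Loops A) : IsFreeGroupoid (FundamentalGroupoid X) where
  quiverGenerators := ⟨fun a b => Gen hL (FundamentalGroupoid.as a) (FundamentalGroupoid.as b)⟩
  of g := Gen.of g
  unique_lift := by
    intro H _ f
    obtain ⟨F, hF⟩ := exists_lift (hL := hL) (fun x y g => f (a := o x) (b := o y) g)
    refine ⟨F, fun a b g => hF _ _ g, ?_⟩
    intro G hG
    refine lift_unique (hL := hL) G F ?_
    intro x y g
    exact (hG (o x) (o y) g).trans (hF x y g).symm

end side

lemma main [Finite X] [ConnectedSpace X] {A : Set X} (hL : Loops A) (x₀ : X) :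
    IsFreeGroup (FundamentalGroup X x₀) := by
  have : PathConnectedSpace X := by
    refine ⟨⟨x₀⟩, fun x y => ?_⟩
    have ho : ∀ P : Set X, (∀ a b, b ⤳ a → a ∈ P → b ∈ P) → IsOpen P := by
      intro P hP
      rw [isOpen_iff_forall_mem_open]
      intro a ha
      exact ⟨_, fun b hb => hP a b hb ha, isOpen_N a, specializes_rfl⟩
    have hC : IsClopen {z | Joined x z} := by
      refine ⟨⟨ho _ ?_⟩, ho _ ?_⟩
      · intro a b hb ha hj
        exact ha (Joined.trans hj ⟨ep (Or.inl hb)⟩)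
      · intro a b hb ha
        exact Joined.trans ha ⟨ep (Or.inr hb)⟩
    have := hC.eq_univ ⟨x, Joined.refl x⟩
    have hy : y ∈ {z | Joined x z} := by rw [this]; exact mem_univ y
    exact hy
  have : IsConnected (FundamentalGroupoid X) := by
    have : Nonempty (FundamentalGroupoid X) := ⟨o x₀⟩
    refine zigzag_isConnected fun a b => Relation.ReflTransGen.single (Or.inl ⟨?_⟩)
    exact cls (PathConnectedSpace.somePath a.as b.as)
  let _ := free hL
  exact IsFreeGroupoid.endIsFreeOfConnectedFree (o x₀)

lemma mem_comp {B : Set X} {x : X} (p : Path x x) (hp : ∀ t, p t ∈ B) (t) :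
    p t ∈ connectedComponentIn B x := by
  have : IsPreconnected (range p) := isPreconnected_range p.continuous
  exact this.subset_connectedComponentIn ⟨0, p.source⟩ (by rintro _ ⟨s, rfl⟩; exact hp s) ⟨t, rfl⟩

end FinFree

/-- Let `X` be a finite, connected `T₀` topological space.  Suppose there are a nonempty proper
subset `A ⊊ X` and `n ≥ 2` such that every connected component of `A` is `n`-connected and the
inclusion of every connected component of `X∖A` into `X` induces the trivial morphism on
fundamental groups (i.e. every loop in such a component is null-homotopic in `X`).  Then the
fundamental group of `X` is free. -/
theorem stmt17 {X : Type*} [TopologicalSpace X] [Finite X] [T0Space X] [ConnectedSpace X]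
    (A : Set X) (hne : A.Nonempty) (hproper : A ≠ Set.univ) (n : ℕ) (hn : 2 ≤ n)
    (hconn : ∀ a ∈ A,
      PathConnectedSpace ↥(connectedComponentIn A a) ∧
        ∀ k : ℕ, 1 ≤ k → k ≤ n → ∀ p : ↥(connectedComponentIn A a),
          Subsingleton (HomotopyGroup (Fin k) ↥(connectedComponentIn A a) p))
    (htriv : ∀ b : X, ∀ hb : b ∈ Aᶜ,
      ∀ γ : Path (⟨b, mem_connectedComponentIn hb⟩ : ↥(connectedComponentIn Aᶜ b))
            ⟨b, mem_connectedComponentIn hb⟩,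
        (γ.map continuous_subtype_val).Homotopic (Path.refl b)) :
    ∀ x₀ : X, IsFreeGroup (FundamentalGroup X x₀) := by
  apply FinFree.main (A := A)
  intro x p hp
  by_cases hx : x ∈ A
  · have hm := FinFree.mem_comp p (fun t => (hp t).2 hx)
    let x' : ↥(connectedComponentIn A x) := ⟨x, mem_connectedComponentIn hx⟩
    let q : Path x' x' :=
      { toFun := fun t => ⟨p t, hm t⟩
        continuous_toFun := by fun_prop
        source' := Subtype.ext p.source
        target' := Subtype.ext p.target }
    have hs := (hconn x hx).2 1 le_rfl (by omega) x'
    have hs' : Subsingleton (FundamentalGroup _ x') :=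
      HomotopyGroup.pi1EquivFundamentalGroup.symm.subsingleton
    have h1 : q.Homotopic (Path.refl x') :=
      FinFree.cls_eq.1 (hs'.elim (FinFree.cls q) (FinFree.cls (Path.refl x')))
    exact h1.map ⟨Subtype.val, continuous_subtype_val⟩
  · have hx' : x ∈ Aᶜ := hx
    have hm := FinFree.mem_comp (B := Aᶜ) p (fun t h => hx ((hp t).1 h))
    exact htriv x hx'
      { toFun := fun t => ⟨p t, hm t⟩
        continuous_toFun := by fun_prop
        source' := Subtype.ext p.source
        target' := Subtype.ext p.target }
end
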